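/- arXiv:2205.03487 — 3 statements merged into one kernel-verified Lean document; each statement's English description precedes it below -/
import Mathlib

section
/- Let D=(E,𝓕) be a normal binary delta-matroid. Then the twist polynomial of D is a monomial (i.e., there exists k such that w(D*A)=k for every A⊆E) if and only if every connected component of the intersection graph G_D is either a complete graph of odd order (with no loops at its vertices) or a single vertex carrying a loop. -/
open Finset
open scoped symmDiff

noncomputable section

namespace DeltaMatroid

variable {α : Type*} [DecidableEq α]

/-- A delta-matroid on ground set `E` with feasible sets `F`: `F` is nonempty, consists of
subsets of `E`, and satisfies the symmetric exchange axiom. -/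
def IsDeltaMatroid (E : Finset α) (F : Finset (Finset α)) : Prop :=
  F.Nonempty ∧ (∀ X ∈ F, X ⊆ E) ∧
    ∀ X ∈ F, ∀ Y ∈ F, ∀ u ∈ X ∆ Y, ∃ v ∈ X ∆ Y, X ∆ ({u, v} : Finset α) ∈ F

/-- The twist `D * A` of the feasible sets by a subset `A`. -/
def twist (F : Finset (Finset α)) (A : Finset α) : Finset (Finset α) :=
  F.image fun X => A ∆ X

/-- Maximum cardinality of a feasible set. -/
def maxCard (F : Finset (Finset α)) : ℕ := F.sup Finset.card

/-- Minimum cardinality of a feasible set. -/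
def minCard (F : Finset (Finset α)) : ℕ := sInf (Finset.card '' (F : Set (Finset α)))

/-- The width `w(D)`. -/
def width (F : Finset (Finset α)) : ℕ := maxCard F - minCard F

/-- Feasible sets of minimum cardinality. -/
def Fmin (F : Finset (Finset α)) : Finset (Finset α) := F.filter fun X => X.card = minCard F

/-- Feasible sets of maximum cardinality. -/
def Fmax (F : Finset (Finset α)) : Finset (Finset α) := F.filter fun X => X.card = maxCard F

/-- `e` is a ribbon loop: it lies in no minimum-cardinality feasible set. -/
def IsRibbonLoop (F : Finset (Finset α)) (e : α) : Prop := ∀ X ∈ Fmin F, e ∉ X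

/-- A ribbon loop is non-orientable if it is also a ribbon loop of `D * e`. -/
def IsNonorientableRibbonLoop (F : Finset (Finset α)) (e : α) : Prop :=
  IsRibbonLoop F e ∧ IsRibbonLoop (twist F {e}) e

/-- A ribbon loop is orientable if it is not a ribbon loop of `D * e`. -/
def IsOrientableRibbonLoop (F : Finset (Finset α)) (e : α) : Prop :=
  IsRibbonLoop F e ∧ ¬ IsRibbonLoop (twist F {e}) e

/-- `e` is a loop: it lies in no feasible set. -/
def IsLoop (F : Finset (Finset α)) (e : α) : Prop := ∀ X ∈ F, e ∉ X

/-- `e` is a coloop: it lies in every feasible set. -/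
def IsColoop (F : Finset (Finset α)) (e : α) : Prop := ∀ X ∈ F, e ∈ X

/-- Contraction `D / e`. -/
def contract (F : Finset (Finset α)) (e : α) : Finset (Finset α) :=
  if ∀ X ∈ F, e ∉ X then F
  else (F.filter fun X => e ∈ X).image fun X => X.erase e

/-- Deletion `D \ e`. -/
def delete (F : Finset (Finset α)) (e : α) : Finset (Finset α) :=
  if ∀ X ∈ F, e ∈ X then F.image fun X => X.erase e
  else F.filter fun X => e ∉ X

/-- Deletion of every element of `A` (in some order; the order does not matter). -/
def deleteSet (F : Finset (Finset α)) (A : Finset α) : Finset (Finset α) :=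
  A.toList.foldl delete F

/-- The restriction `D |_A = D \ (E \ A)` of a delta-matroid with ground set `E`. -/
def restrict (F : Finset (Finset α)) (E A : Finset α) : Finset (Finset α) :=
  deleteSet F (E \ A)

/-- Feasible sets of the direct sum `D ⊕ D'`. -/
def directSum (F G : Finset (Finset α)) : Finset (Finset α) :=
  (F ×ˢ G).image fun p => p.1 ∪ p.2

/-- A delta-matroid is connected if it is not a direct sum of two delta-matroids on
nonempty ground sets. -/
def IsConnected (E : Finset α) (F : Finset (Finset α)) : Prop :=
  ¬ ∃ (E₁ E₂ : Finset α) (F₁ F₂ : Finset (Finset α)),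
      E₁.Nonempty ∧ E₂.Nonempty ∧ Disjoint E₁ E₂ ∧ E = E₁ ∪ E₂ ∧
      IsDeltaMatroid E₁ F₁ ∧ IsDeltaMatroid E₂ F₂ ∧ F = directSum F₁ F₂

/-- A delta-matroid is even if all feasible sets have the same parity of cardinality. -/
def IsEvenDM (F : Finset (Finset α)) : Prop :=
  ∀ X ∈ F, ∀ Y ∈ F, X.card % 2 = Y.card % 2

variable {ι : Type*} [Fintype ι] [DecidableEq ι]

/-- The feasible sets of `D(C)`: subsets `A` whose principal submatrix `C[A]` is nonsingular
(over `GF(2)`, i.e. has nonzero determinant); `C[∅]` is nonsingular by convention. -/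
def binaryFeasible (C : Matrix ι ι (ZMod 2)) : Finset (Finset ι) :=
  Finset.univ.filter fun A =>
    (C.submatrix (fun x : {a // a ∈ A} => (x : ι)) (fun x : {a // a ∈ A} => (x : ι))).det ≠ 0

/-- The (simple-graph part of the) intersection graph `G_D` of a normal binary delta-matroid
`D(C)`: distinct `u, v` adjacent iff `C u v = 1`.  Loops are recorded by the diagonal of `C`. -/
def interGraph (C : Matrix ι ι (ZMod 2)) : SimpleGraph ι :=
  SimpleGraph.fromRel fun u v => C u v = 1


/-- Kernel of the principal submatrix `C[A]`, extended by zero. -/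
def ker (C : Matrix ι ι (ZMod 2)) (A : Finset ι) : Submodule (ZMod 2) (ι → ZMod 2) where
  carrier := {x | (∀ i, i ∉ A → x i = 0) ∧ ∀ i ∈ A, (C.mulVec x) i = 0}
  zero_mem' := by simp
  add_mem' := by
    rintro x y ⟨hx, hx'⟩ ⟨hy, hy'⟩
    refine ⟨fun i hi => by simp [hx i hi, hy i hi], fun i hi => ?_⟩
    simp [Matrix.mulVec_add, hx' i hi, hy' i hi]
  smul_mem' := by
    rintro c x ⟨hx, hx'⟩
    refine ⟨fun i hi => by simp [hx i hi], fun i hi => ?_⟩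
    simp [Matrix.mulVec_smul, hx' i hi]

theorem mem_ker {C : Matrix ι ι (ZMod 2)} {A : Finset ι} {x : ι → ZMod 2} :
    x ∈ ker C A ↔ (∀ i, i ∉ A → x i = 0) ∧ ∀ i ∈ A, (C.mulVec x) i = 0 := Iff.rfl

theorem z2 (a : ZMod 2) : a = 0 ∨ a = 1 := by revert a; decide

/-- Nullity. -/
def nul (C : Matrix ι ι (ZMod 2)) (A : Finset ι) : ℕ := Module.finrank (ZMod 2) (ker C A)

theorem pairing {C : Matrix ι ι (ZMod 2)} (hC : C.IsSymm) (x z : ι → ZMod 2) :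
    ∑ i, x i * (C.mulVec z) i = ∑ i, z i * (C.mulVec x) i := by
  have h := Matrix.dotProduct_mulVec x C z
  rw [← Matrix.mulVec_transpose, hC.eq, dotProduct_comm (C.mulVec x)] at h
  exact h

theorem feasible_iff (C : Matrix ι ι (ZMod 2)) (A : Finset ι) :
    A ∈ binaryFeasible C ↔ ker C A = ⊥ := by
  have key : ∀ (x : ι → ZMod 2), (∀ i, i ∉ A → x i = 0) → ∀ i : {a // a ∈ A},
      ((C.submatrix (fun x : {a // a ∈ A} => (x : ι))
        (fun x : {a // a ∈ A} => (x : ι))).mulVec (fun j => x j)) i = (C.mulVec x) i := by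
    intro x hx i
    simp only [Matrix.mulVec, dotProduct, Matrix.submatrix_apply]
    rw [Finset.sum_coe_sort A (fun j => C i j * x j)]
    exact Finset.sum_subset (Finset.subset_univ A) (fun j _ hj => by simp [hx j hj])
  unfold binaryFeasible
  rw [Finset.mem_filter, ne_eq, ← Matrix.exists_mulVec_eq_zero_iff, Submodule.eq_bot_iff]
  simp only [Finset.mem_univ, true_and]
  constructor
  · intro h x hx
    by_contra hne
    apply h
    refine ⟨fun j => x j, ?_, ?_⟩
    · intro h0
      apply hne
      funext i
      by_cases hi : i ∈ A
      · exact congrFun h0 ⟨i, hi⟩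
      · exact hx.1 i hi
    · funext i
      rw [key x hx.1 i]
      exact hx.2 i i.2
  · rintro h ⟨y, hy, hy0⟩
    apply hy
    let x : ι → ZMod 2 := fun i => if hi : i ∈ A then y ⟨i, hi⟩ else 0
    have hxy : (fun j : {a // a ∈ A} => x j) = y := by
      funext j; simp [x]
    have hx0 : ∀ i, i ∉ A → x i = 0 := fun i hi => by simp [x, hi]
    have hx : x ∈ ker C A := by
      refine ⟨hx0, fun i hi => ?_⟩
      rw [← key x hx0 ⟨i, hi⟩, hxy, hy0]; rfl
    rw [← hxy, h x hx]; rfl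

theorem finrank_inf_coord (K : Submodule (ZMod 2) (ι → ZMod 2)) (v : ι) :
    Module.finrank (ZMod 2) K ≤ Module.finrank (ZMod 2)
      (K ⊓ LinearMap.ker (LinearMap.proj v : (ι → ZMod 2) →ₗ[ZMod 2] ZMod 2) :
        Submodule (ZMod 2) (ι → ZMod 2)) + 1 := by
  set f := (LinearMap.proj v : (ι → ZMod 2) →ₗ[ZMod 2] ZMod 2)
  have h1 := Submodule.finrank_sup_add_finrank_inf_eq K (LinearMap.ker f)
  have h2 := LinearMap.finrank_range_add_finrank_ker f
  have h3 : Module.finrank (ZMod 2) (LinearMap.range f) ≤ 1 := by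
    simpa using Submodule.finrank_le (LinearMap.range f)
  have h4 := Submodule.finrank_le (K ⊔ LinearMap.ker f)
  omega

theorem nul_le_dist (C : Matrix ι ι (ZMod 2)) (A X : Finset ι) (hX : ker C X = ⊥) :
    nul C A ≤ (A ∆ X).card := by
  let g : ker C A →ₗ[ZMod 2] ({i // i ∈ A ∆ X} → ZMod 2) :=
    { toFun := fun x i => if i.1 ∈ A then x.1 i else (C.mulVec x.1) i
      map_add' := by
        intro x y; funext i
        by_cases hi : i.1 ∈ A <;> simp [hi, Matrix.mulVec_add]
      map_smul' := by
        intro c x; funext i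
        by_cases hi : i.1 ∈ A <;> simp [hi, Matrix.mulVec_smul] }
  have hg : Function.Injective g := by
    rw [injective_iff_map_eq_zero]
    rintro ⟨x, hx⟩ h
    have h' : ∀ i (hi : i ∈ A ∆ X), (if i ∈ A then x i else (C.mulVec x) i) = 0 :=
      fun i hi => congrFun h ⟨i, hi⟩
    have : x ∈ ker C X := by
      refine ⟨fun i hi => ?_, fun i hi => ?_⟩
      · by_cases hA : i ∈ A
        · have := h' i (by simp [Finset.mem_symmDiff, hA, hi])
          simpa [hA] using this
        · exact hx.1 i hA
      · by_cases hA : i ∈ A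
        · exact hx.2 i hA
        · have := h' i (by simp [Finset.mem_symmDiff, hA, hi])
          simpa [hA] using this
    rw [hX, Submodule.mem_bot] at this
    exact Subtype.ext this
  have := LinearMap.finrank_le_finrank_of_injective hg
  simpa [nul] using this

theorem ker_erase {C : Matrix ι ι (ZMod 2)} (hC : C.IsSymm) {A : Finset ι} {x : ι → ZMod 2}
    (hx : x ∈ ker C A) {v : ι} (hv : x v = 1) {z : ι → ZMod 2} (hz : z ∈ ker C (A.erase v)) :
    z ∈ ker C A := by
  have hz0 : ∀ i, i ∉ A → z i = 0 := fun i hi => hz.1 i (by simp [hi])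
  refine ⟨hz0, fun i hi => ?_⟩
  by_cases hiv : i = v
  · subst hiv
    have h := pairing hC x z
    rw [Finset.sum_eq_single i, hv, one_mul] at h
    · rw [h]
      apply Finset.sum_eq_zero
      intro j _
      by_cases hj : j ∈ A
      · simp [hx.2 j hj]
      · simp [hz0 j hj]
    · intro j _ hj
      by_cases hjA : j ∈ A
      · simp [hz.2 j (by simp [hj, hjA])]
      · simp [hx.1 j hjA]
    · simp
  · exact hz.2 i (by simp [hi, hiv])

theorem exists_feasible {C : Matrix ι ι (ZMod 2)} (hC : C.IsSymm) :
    ∀ (n : ℕ) (A : Finset ι), A.card = n → ∃ X, X ⊆ A ∧ ker C X = ⊥ ∧ (A ∆ X).card ≤ nul C A := by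
  intro n
  induction n with
  | zero =>
    intro A hA
    rw [Finset.card_eq_zero] at hA
    subst hA
    refine ⟨∅, by simp, ?_, by simp⟩
    rw [Submodule.eq_bot_iff]
    intro x hx
    funext i
    exact hx.1 i (by simp)
  | succ n ih =>
    intro A hA
    by_cases h : ker C A = ⊥
    · exact ⟨A, by simp, h, by simp⟩
    · obtain ⟨x, hx, hne⟩ := Submodule.exists_mem_ne_zero_of_ne_bot h
      obtain ⟨v, hv⟩ := Function.ne_iff.mp hne
      have hv1 : x v = 1 := (z2 _).resolve_left hv
      have hvA : v ∈ A := by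
        by_contra hvA
        exact hv (hx.1 v hvA)
      obtain ⟨X, hXA, hX, hc⟩ := ih (A.erase v) (by simp [Finset.card_erase_of_mem hvA, hA])
      refine ⟨X, hXA.trans (Finset.erase_subset _ _), hX, ?_⟩
      have hlt : nul C (A.erase v) < nul C A := by
        apply Submodule.finrank_lt_finrank_of_lt
        refine lt_of_le_of_ne (fun z hz => ker_erase hC hx hv1 hz) ?_
        intro he
        rw [← he] at hx
        exact hv (hx.1 v (by simp))
      have : (A ∆ X).card ≤ ((A.erase v) ∆ X).card + 1 := by
        refine (Finset.card_le_card ?_).trans (Finset.card_insert_le v _)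
        intro i hi
        simp only [Finset.mem_symmDiff, Finset.mem_insert, Finset.mem_erase] at hi ⊢
        tauto
      omega

theorem card_compl_symmDiff (A X : Finset ι) :
    (A ∆ X).card + (Aᶜ ∆ X).card = Fintype.card ι := by
  have : Aᶜ ∆ X = (A ∆ X)ᶜ := by
    ext i; simp only [Finset.mem_symmDiff, Finset.mem_compl]; tauto
  rw [this, Finset.card_add_card_compl]

theorem nul_add_le {C : Matrix ι ι (ZMod 2)} (hC : C.IsSymm) (A : Finset ι) :
    nul C A + nul C Aᶜ ≤ Fintype.card ι := by
  obtain ⟨X, -, hX, -⟩ := exists_feasible hC _ A rfl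
  have := card_compl_symmDiff A X
  have := nul_le_dist C A X hX
  have := nul_le_dist C Aᶜ X hX
  omega

theorem width_eq {C : Matrix ι ι (ZMod 2)} (hC : C.IsSymm) (A : Finset ι) :
    width (twist (binaryFeasible C) A) + (nul C A + nul C Aᶜ) = Fintype.card ι := by
  have hle := nul_add_le hC A
  have hmin : minCard (twist (binaryFeasible C) A) = nul C A := by
    obtain ⟨X, -, hX, hc⟩ := exists_feasible hC _ A rfl
    have hc := le_antisymm hc (nul_le_dist C A X hX)
    apply le_antisymm
    · apply Nat.sInf_le
      refine ⟨A ∆ X, ?_, hc⟩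
      rw [Finset.mem_coe]
      exact Finset.mem_image_of_mem _ ((feasible_iff C X).2 hX)
    · apply le_csInf
      · exact ⟨_, A ∆ X, Finset.mem_coe.2
          (Finset.mem_image_of_mem _ ((feasible_iff C X).2 hX)), rfl⟩
      · rintro _ ⟨Y, hY, rfl⟩
        obtain ⟨Z, hZ, rfl⟩ := Finset.mem_image.1 (Finset.mem_coe.1 hY)
        exact nul_le_dist C A Z ((feasible_iff C Z).1 hZ)
  have hmax : maxCard (twist (binaryFeasible C) A) = Fintype.card ι - nul C Aᶜ := by
    obtain ⟨X, -, hX, hc⟩ := exists_feasible hC _ Aᶜ rfl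
    have hc := le_antisymm hc (nul_le_dist C Aᶜ X hX)
    apply le_antisymm
    · apply Finset.sup_le
      intro Y hY
      obtain ⟨Z, hZ, rfl⟩ := Finset.mem_image.1 hY
      have := nul_le_dist C Aᶜ Z ((feasible_iff C Z).1 hZ)
      have := card_compl_symmDiff A Z
      omega
    · have h1 := card_compl_symmDiff A X
      have h2 : (A ∆ X).card ≤ maxCard (twist (binaryFeasible C) A) :=
        Finset.le_sup (f := Finset.card)
          (Finset.mem_image_of_mem _ ((feasible_iff C X).2 hX))
      omega
  unfold width
  omega

theorem const_iff {C : Matrix ι ι (ZMod 2)} (hC : C.IsSymm) :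
    (∃ k : ℕ, ∀ A : Finset ι, width (twist (binaryFeasible C) A) = k) ↔
      ∀ A : Finset ι, nul C A + nul C Aᶜ = nul C Finset.univ := by
  have h0 : nul C ∅ = 0 := by
    have : ker C ∅ = ⊥ := by
      rw [Submodule.eq_bot_iff]
      intro x hx
      funext i
      exact hx.1 i (by simp)
    simp [nul, this]
  constructor
  · rintro ⟨k, hk⟩ A
    have h1 := width_eq hC A
    have h2 := width_eq hC ∅
    rw [hk] at h1 h2
    rw [h0, Finset.compl_empty] at h2
    omega
  · intro h
    refine ⟨Fintype.card ι - nul C Finset.univ, fun A => ?_⟩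
    have h1 := width_eq hC A
    rw [h] at h1
    omega

theorem vadd_self (x : ι → ZMod 2) : x + x = 0 := by
  funext i
  exact CharTwo.add_self_eq_zero (x i)

theorem suff {C L : Matrix ι ι (ZMod 2)} (hLC : L = 1 + C) (hC : C.IsSymm)
    (ha : ∀ i j k, L i j = 1 → L i k = L j k) (hb : ∀ i, ∑ j, L i j = L i i) (A : Finset ι) :
    nul C A + nul C Aᶜ = nul C Finset.univ := by
  have hLs : ∀ i j, L i j = L j i := by
    intro i j
    rw [hLC]
    simp only [Matrix.add_apply, Matrix.one_apply, hC.apply, eq_comm]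
  have hmul : ∀ x : ι → ZMod 2, C.mulVec x = x + L.mulVec x := by
    intro x
    rw [hLC, Matrix.add_mulVec, Matrix.one_mulVec, ← add_assoc, vadd_self, zero_add]
  have hii : ∀ i j, L i j = 1 → L i i = 1 := fun i j h => by rw [ha i j i h, ← hLs, h]
  have hsq : L * L = L := by
    ext i k
    rw [Matrix.mul_apply]
    have : ∀ j, L i j * L j k = L i j * L i k := by
      intro j
      rcases z2 (L i j) with h | h
      · simp [h]
      · rw [ha i j k h]
    rw [Finset.sum_congr rfl (fun j _ => this j), ← Finset.sum_mul, hb]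
    rcases z2 (L i k) with h | h
    · simp [h]
    · rw [hii i k h, one_mul]
  have hsq' : ∀ x : ι → ZMod 2, L.mulVec (L.mulVec x) = L.mulVec x := by
    intro x; rw [Matrix.mulVec_mulVec, hsq]
  let Φ : (ker C A × ker C Aᶜ) →ₗ[ZMod 2] ker C Finset.univ :=
    { toFun := fun p => ⟨L.mulVec (p.1.1 + p.2.1), by
        refine ⟨by simp, fun i _ => ?_⟩
        rw [hmul, hsq', vadd_self]; rfl⟩
      map_add' := by
        intro p q
        apply Subtype.ext
        simp only [Prod.fst_add, Prod.snd_add, Submodule.coe_add, Matrix.mulVec_add]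
        abel
      map_smul' := by
        intro c p
        apply Subtype.ext
        simp [Matrix.mulVec_add, Matrix.mulVec_smul] }
  have hinj : Function.Injective Φ := by
    rw [injective_iff_map_eq_zero]
    rintro ⟨⟨x, hx⟩, ⟨y, hy⟩⟩ h
    have h1 : L.mulVec (x + y) = 0 := congrArg Subtype.val h
    have h2 : C.mulVec x + C.mulVec y = x + y := by
      rw [← Matrix.mulVec_add, hmul, h1, add_zero]
    have h3 : ∀ i, C.mulVec x i + C.mulVec y i = x i + y i := fun i => congrFun h2 i
    have hyx : C.mulVec y = x := by
      funext i
      have := h3 i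
      by_cases hi : i ∈ A
      · rw [hx.2 i hi, hy.1 i (by simp [hi])] at this
        simpa using this
      · rw [hy.2 i (by simp [hi]), hx.1 i hi]
    have hxy : C.mulVec x = y := by
      rw [hyx, add_comm] at h2
      exact add_left_cancel h2
    have hxx : C.mulVec x = x := by
      conv_lhs => rw [← hyx]
      rw [hmul (C.mulVec y), hmul y, Matrix.mulVec_add, hsq', vadd_self, add_zero,
        ← hmul, hyx]
    have he : x = y := hxx.symm.trans hxy
    have hx0 : x = 0 := by
      funext i
      by_cases hi : i ∈ A
      · rw [he]; exact hy.1 i (by simp [hi])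
      · exact hx.1 i hi
    subst he
    subst hx0
    rfl
  have hsurj : Function.Surjective Φ := by
    rintro ⟨x, hx⟩
    have hLx : L.mulVec x = x := by
      have : C.mulVec x = 0 := funext fun i => hx.2 i (Finset.mem_univ i)
      rw [hmul] at this
      funext i
      have h1 : x i + L.mulVec x i = 0 := congrFun this i
      exact (CharTwo.add_eq_zero.1 h1).symm
    have hLx' : ∀ i, ∑ j, L i j * x j = x i := fun i => congrFun hLx i
    have hxc : ∀ i j, L i j = 1 → x i = x j := by
      intro i j h
      rw [← hLx' i, ← hLx' j]
      exact Finset.sum_congr rfl fun k _ => by rw [ha i j k h]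
    let a : Finset ι → ι → ZMod 2 := fun B i => ∑ j ∈ B, L i j
    let u : Finset ι → ι → ZMod 2 := fun B i => if i ∈ B then x i * a B i else 0
    have hac : ∀ B i j, L i j = 1 → a B i = a B j := fun B i j h =>
      Finset.sum_congr rfl fun k _ => by rw [ha i j k h]
    have hLu : ∀ B i, L.mulVec (u B) i = x i * a B i := by
      intro B i
      have h1 : L.mulVec (u B) i = ∑ j ∈ B, L i j * (x i * a B i) := by
        have h2 : L.mulVec (u B) i = ∑ j ∈ B, L i j * u B j :=
          (Finset.sum_subset (Finset.subset_univ B) (by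
            intro j _ hj; simp [u, hj])).symm
        rw [h2]
        · apply Finset.sum_congr rfl
          intro j hj
          simp only [u, hj, if_true]
          rcases z2 (L i j) with h | h
          · simp [h]
          · rw [hxc i j h, hac B i j h]
      rw [h1, ← Finset.sum_mul]
      change a B i * _ = _
      rcases z2 (a B i) with h | h <;> simp [h]
    have hu : ∀ B, u B ∈ ker C B := by
      intro B
      refine ⟨fun i hi => by simp [u, hi], fun i hi => ?_⟩
      rw [hmul, Pi.add_apply, hLu]
      simp only [u, hi, if_true]
      exact CharTwo.add_self_eq_zero (R := ZMod 2) _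
    refine ⟨(⟨u A, hu A⟩, ⟨u Aᶜ, hu Aᶜ⟩), ?_⟩
    apply Subtype.ext
    change L.mulVec (u A + u Aᶜ) = x
    funext i
    rw [Matrix.mulVec_add, Pi.add_apply, hLu, hLu, ← mul_add, Finset.sum_add_sum_compl, hb]
    rcases z2 (L i i) with h | h
    · have : ∀ j, L i j = 0 := by
        intro j
        rcases z2 (L i j) with h' | h'
        · exact h'
        · rw [hii i j h'] at h; simp at h
      rw [← hLx' i]
      simp [this]
    · rw [h, mul_one]
  have := (LinearEquiv.ofBijective Φ ⟨hinj, hsurj⟩).finrank_eq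
  rw [Module.finrank_prod] at this
  exact this

theorem adj_iff {C : Matrix ι ι (ZMod 2)} (hC : C.IsSymm) (u v : ι) :
    (interGraph C).Adj u v ↔ u ≠ v ∧ C u v = 1 := by
  simp [interGraph, SimpleGraph.fromRel_adj, hC.apply]

theorem reverse_dir {C : Matrix ι ι (ZMod 2)} (hC : C.IsSymm)
    (H : ∀ v : ι,
        ((∀ u w : ι, (interGraph C).Reachable u v → (interGraph C).Reachable w v →
            u ≠ w → (interGraph C).Adj u w) ∧
          Odd (Set.ncard {u : ι | (interGraph C).Reachable u v}) ∧
          (∀ u : ι, (interGraph C).Reachable u v → C u u = 0)) ∨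
        ((∀ u : ι, (interGraph C).Reachable u v → u = v) ∧ C v v = 1)) (A : Finset ι) :
    nul C A + nul C Aᶜ = nul C Finset.univ := by
  classical
  have hL : ∀ i j, (1 + C) i j = 1 ↔ (interGraph C).Reachable i j ∧ C i i = 0 := by
    intro i j
    rw [Matrix.add_apply, Matrix.one_apply]
    by_cases hij : i = j
    · subst hij
      rcases z2 (C i i) with h | h <;> simp [h]
    · simp only [hij, if_false, zero_add]
      constructor
      · intro h
        have hadj : (interGraph C).Adj i j := (adj_iff hC i j).2 ⟨hij, h⟩
        refine ⟨hadj.reachable, ?_⟩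
        rcases H j with h1 | h1
        · exact h1.2.2 i hadj.reachable
        · exact absurd (h1.1 i hadj.reachable) hij
      · rintro ⟨h, -⟩
        rcases H j with h1 | h1
        · exact ((adj_iff hC i j).1 (h1.1 i j h (SimpleGraph.Reachable.refl _) hij)).2
        · exact absurd (h1.1 i h) hij
  have hloop : ∀ i j, (interGraph C).Reachable i j → C j j = 0 → C i i = 0 := by
    intro i j h hj
    rcases H j with h1 | h1
    · exact h1.2.2 i h
    · rw [h1.1 i h]; exact hj
  have h01 : ∀ a b : ZMod 2, (a = 1 ↔ b = 1) → a = b := by decide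
  refine suff rfl hC ?_ ?_ A
  · intro i j k h
    obtain ⟨h1, h2⟩ := (hL i j).1 h
    have h3 := hloop j i h1.symm h2
    apply h01
    rw [hL, hL]
    exact ⟨fun h => ⟨h1.symm.trans h.1, h3⟩, fun h => ⟨h1.trans h.1, h2⟩⟩
  · intro i
    have hv : ∀ j, (1 + C) i j = if (interGraph C).Reachable j i ∧ C i i = 0 then 1 else 0 := by
      intro j
      split_ifs with h
      · exact (hL i j).2 ⟨h.1.symm, h.2⟩
      · rcases z2 ((1 + C) i j) with h' | h'
        · exact h'
        · exact absurd ⟨((hL i j).1 h').1.symm, ((hL i j).1 h').2⟩ h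
    rw [Finset.sum_congr rfl fun j _ => hv j, hv i]
    rcases H i with h1 | h1
    · have hi := h1.2.2 i (SimpleGraph.Reachable.refl _)
      have ho := h1.2.1
      simp only [hi, and_true, SimpleGraph.Reachable.refl, if_true]
      rw [Finset.sum_boole]
      rw [Set.ncard_eq_toFinset_card' ] at ho
      rw [ZMod.natCast_eq_one_iff_odd]
      convert ho using 2
      ext; simp
    · simp [h1.2]

theorem nul_of_lt {C : Matrix ι ι (ZMod 2)} {A : Finset ι} (K : Submodule (ZMod 2) (ι → ZMod 2))
    (h : ker C A ≤ K) : nul C A ≤ Module.finrank (ZMod 2) K := Submodule.finrank_mono h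

set_option maxHeartbeats 1000000 in
theorem forward_dir {C : Matrix ι ι (ZMod 2)} (hC : C.IsSymm)
    (H : ∀ A : Finset ι, nul C A + nul C Aᶜ = nul C Finset.univ) (v : ι) :
        ((∀ u w : ι, (interGraph C).Reachable u v → (interGraph C).Reachable w v →
            u ≠ w → (interGraph C).Adj u w) ∧
          Odd (Set.ncard {u : ι | (interGraph C).Reachable u v}) ∧
          (∀ u : ι, (interGraph C).Reachable u v → C u u = 0)) ∨
        ((∀ u : ι, (interGraph C).Reachable u v → u = v) ∧ C v v = 1) := by
  classical
  have hU : ∀ x, x ∈ ker C Finset.univ ↔ ∀ i, C.mulVec x i = 0 := by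
    intro x; simp [mem_ker]
  -- pairing of a kernel vector with an arbitrary one
  have hpair : ∀ x ∈ ker C Finset.univ, ∀ z, ∑ i, x i * C.mulVec z i = 0 := by
    intro x hx z
    rw [pairing hC]
    exact Finset.sum_eq_zero fun i _ => by rw [hx.2 i (Finset.mem_univ i), mul_zero]
  have hpair2 : ∀ u w, u ≠ w → ∀ x ∈ ker C Finset.univ, ∀ z ∈ ker C ({u, w} : Finset ι)ᶜ,
      x u * C.mulVec z u + x w * C.mulVec z w = 0 := by
    intro u w huw x hx z hz
    rw [← hpair x hx z, ← Finset.sum_pair huw (f := fun i => x i * C.mulVec z i)]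
    apply Finset.sum_subset (Finset.subset_univ _)
    intro i _ hi
    rw [hz.2 i (by simpa using hi), mul_zero]
  have hpair1 : ∀ u, ∀ x ∈ ker C Finset.univ, ∀ z ∈ ker C ({u} : Finset ι)ᶜ,
      x u * C.mulVec z u = 0 := by
    intro u x hx z hz
    rw [← hpair x hx z]
    symm
    apply Finset.sum_eq_single u
    · intro i _ hi
      rw [hz.2 i (by simpa using hi), mul_zero]
    · simp
  -- mulVec of a vector supported on a small set
  have hsup : ∀ (A : Finset ι) x, (∀ i, i ∉ A → x i = 0) → ∀ i,
      C.mulVec x i = ∑ j ∈ A, C i j * x j := by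
    intro A x hx i
    symm
    exact Finset.sum_subset (Finset.subset_univ A) fun j _ hj => by rw [hx j hj, mul_zero]
  have hne_bot : ∀ A : Finset ι, ∀ x ∈ ker C A, x ≠ 0 → 0 < nul C A := by
    intro A x hx h0
    rw [nul, Module.finrank_pos_iff_exists_ne_zero]
    exact ⟨⟨x, hx⟩, fun h => h0 (congrArg Subtype.val h)⟩
  have hbot : ∀ A : Finset ι, (∀ x ∈ ker C A, x = 0) → nul C A = 0 := by
    intro A h
    have : ker C A = ⊥ := (Submodule.eq_bot_iff _).2 h
    simp [nul, this]
  -- non-loops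
  have hnl : ∀ u, C u u = 0 → ∃ x ∈ ker C Finset.univ, x u = 1 := by
    intro u hu
    by_contra hno
    push Not at hno
    have h1 : 0 < nul C {u} := by
      apply hne_bot {u} (Pi.single u 1)
      · refine ⟨fun i hi => by simp at hi; simp [hi], fun i hi => ?_⟩
        simp at hi
        simp [hi, hu]
      · intro h; have := congrFun h u; simp at this
    have h2 : nul C Finset.univ ≤ nul C ({u} : Finset ι)ᶜ := by
      apply Submodule.finrank_mono
      intro x hx
      refine ⟨fun i hi => ?_, fun i _ => hx.2 i (Finset.mem_univ i)⟩
      simp at hi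
      subst hi
      exact (z2 _).resolve_right (hno x hx)
    have := H {u}
    omega
  -- loops
  have hl0 : ∀ u, C u u = 1 → nul C {u} = 0 := by
    intro u hu
    apply hbot
    intro x hx
    have h1 := hx.2 u (by simp)
    rw [hsup {u} x hx.1, Finset.sum_singleton, hu, one_mul] at h1
    funext i
    by_cases hi : i = u
    · rw [hi]; exact h1
    · exact hx.1 i (by simpa using hi)
  have hl : ∀ u, C u u = 1 → ∀ x ∈ ker C Finset.univ, x u = 0 := by
    intro u hu x hx
    refine (z2 _).resolve_right fun hxu => ?_
    have h1 := H {u}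
    rw [hl0 u hu, zero_add] at h1
    have : nul C ({u} : Finset ι)ᶜ < nul C Finset.univ := by
      apply Submodule.finrank_lt_finrank_of_lt
      refine lt_of_le_of_ne ?_ ?_
      · intro z hz
        rw [hU]
        intro i
        by_cases hi : i = u
        · subst hi
          simpa [hxu] using hpair1 i x hx z hz
        · exact hz.2 i (by simpa using hi)
      · intro he
        rw [← he] at hx
        rw [hx.1 u (by simp)] at hxu
        simp at hxu
    omega
  have hlK : ∀ u, C u u = 1 → ker C Finset.univ = ker C ({u} : Finset ι)ᶜ := by
    intro u hu
    apply Submodule.eq_of_le_of_finrank_eq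
    · intro x hx
      refine ⟨fun i hi => ?_, fun i _ => hx.2 i (Finset.mem_univ i)⟩
      simp at hi
      subst hi
      exact hl i hu x hx
    · have h1 := H {u}
      rw [hl0 u hu, zero_add] at h1
      exact h1.symm
  have hinf : ∀ u w, (∀ x ∈ ker C Finset.univ, x u = 0 → x w = 0) →
      nul C Finset.univ ≤ nul C ({u, w} : Finset ι)ᶜ + 1 := by
    intro u w h
    refine (finrank_inf_coord (ker C Finset.univ) u).trans (Nat.add_le_add_right ?_ 1)
    apply Submodule.finrank_mono
    rintro x ⟨hx, hxu⟩
    have hxu : x u = 0 := hxu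
    refine ⟨fun i hi => ?_, fun i _ => hx.2 i (Finset.mem_univ i)⟩
    simp only [Finset.mem_compl, not_not, Finset.mem_insert, Finset.mem_singleton] at hi
    rcases hi with rfl | rfl
    · exact hxu
    · exact h x hx hxu
  -- adjacency with loop gives contradiction
  have hiso : ∀ u w, u ≠ w → C u u = 1 → C u w = 0 := by
    intro u w huw hu
    refine (z2 _).resolve_right fun huw1 => ?_
    have hwu1 : C w u = 1 := by rw [hC.apply]; exact huw1
    have hpairH := H {u, w}
    rcases z2 (C w w) with hw | hw
    · have h0 : nul C {u, w} = 0 := by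
        apply hbot
        intro x hx
        have h1 := hx.2 u (by simp)
        have h2 := hx.2 w (by simp)
        rw [hsup {u, w} x hx.1, Finset.sum_pair huw, hu, huw1, one_mul, one_mul] at h1
        rw [hsup {u, w} x hx.1, Finset.sum_pair huw, hw, hwu1, one_mul, zero_mul, add_zero] at h2
        rw [h2, zero_add] at h1
        funext i
        by_cases hi : i = u
        · rw [hi]; exact h2
        · by_cases hi' : i = w
          · rw [hi']; exact h1
          · exact hx.1 i (by simp [hi, hi'])
      obtain ⟨x, hx, hxw⟩ := hnl w hw
      have hxu := hl u hu x hx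
      have : nul C ({u, w} : Finset ι)ᶜ < nul C Finset.univ := by
        apply Submodule.finrank_lt_finrank_of_lt
        refine lt_of_le_of_ne ?_ ?_
        · intro z hz
          rw [hlK u hu]
          refine ⟨fun i hi => hz.1 i (by simp at hi; simp [hi]), fun i hi => ?_⟩
          by_cases hiw : i = w
          · subst hiw
            simpa [hxu, hxw] using hpair2 u i huw x hx z hz
          · exact hz.2 i (by simp at hi; simp [hi, hiw])
        · intro he
          rw [← he] at hx
          rw [hx.1 w (by simp)] at hxw
          simp at hxw
      omega
    · have h1 : 0 < nul C {u, w} := by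
        apply hne_bot {u, w} (Pi.single u 1 + Pi.single w 1)
        · refine ⟨fun i hi => by simp at hi; simp [hi], fun i hi => ?_⟩
          simp at hi
          rw [Matrix.mulVec_add]
          rcases hi with rfl | rfl
          · simp [hu, huw1, CharTwo.add_self_eq_zero]
          · simp [hw, hwu1, CharTwo.add_self_eq_zero]
        · intro h; have := congrFun h u; simp [huw] at this
      have h2 : nul C Finset.univ ≤ nul C ({u, w} : Finset ι)ᶜ := by
        apply Submodule.finrank_mono
        intro x hx
        refine ⟨fun i hi => ?_, fun i _ => hx.2 i (Finset.mem_univ i)⟩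
        simp only [Finset.mem_compl, not_not, Finset.mem_insert, Finset.mem_singleton] at hi
        rcases hi with rfl | rfl
        · exact hl _ hu x hx
        · exact hl _ hw x hx
      omega
  -- pairs of non-loops
  have hnadj : ∀ u w, u ≠ w → C u u = 0 → C w w = 0 →
      (∀ x ∈ ker C Finset.univ, x u = x w) → C u w = 1 := by
    intro u w huw hu hw hall
    refine (z2 _).resolve_left fun huw0 => ?_
    have hwu0 : C w u = 0 := by rw [hC.apply]; exact huw0
    have h1 := hinf u w (fun x hx h => by rw [← hall x hx]; exact h)
    have hKu : (Pi.single u 1 : ι → ZMod 2) ∈ ker C {u, w} := by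
      refine ⟨fun i hi => by simp at hi; simp [hi], fun i hi => ?_⟩
      simp at hi
      rcases hi with rfl | rfl <;> simp [*]
    have hKw : (Pi.single w 1 : ι → ZMod 2) ∈ ker C {u, w} := by
      refine ⟨fun i hi => by simp at hi; simp [hi], fun i hi => ?_⟩
      simp at hi
      rcases hi with rfl | rfl <;> simp [*]
    have h2 : 2 ≤ nul C {u, w} := by
      by_contra hlt
      have hle : nul C {u, w} ≤ 1 := by omega
      obtain ⟨e, he⟩ := finrank_le_one_iff.1 hle
      obtain ⟨c, hc⟩ := he ⟨_, hKu⟩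
      obtain ⟨d, hd⟩ := he ⟨_, hKw⟩
      have hc' : c • e.1 = Pi.single u 1 := congrArg Subtype.val hc
      have hd' : d • e.1 = Pi.single w 1 := congrArg Subtype.val hd
      have c1 := congrFun hc' u
      have d1 := congrFun hd' u
      have d2 := congrFun hd' w
      simp [huw] at c1 d1 d2
      rcases d1 with d1 | d1
      · rw [d1] at d2; simp at d2
      · rw [d1] at c1; simp at c1
    have := H {u, w}
    omega
  have hadj : ∀ u w, u ≠ w → C u u = 0 → C w w = 0 → C u w = 1 →
      ∀ x ∈ ker C Finset.univ, x u = 1 → x w = 1 := by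
    intro u w huw hu hw huw1 x hx hxu
    refine (z2 _).resolve_left fun hxw => ?_
    have hwu1 : C w u = 1 := by rw [hC.apply]; exact huw1
    have h0 : nul C {u, w} = 0 := by
      apply hbot
      intro x hx
      have h1 := hx.2 u (by simp)
      have h2 := hx.2 w (by simp)
      rw [hsup {u, w} x hx.1, Finset.sum_pair huw, hu, huw1, one_mul, zero_mul, zero_add] at h1
      rw [hsup {u, w} x hx.1, Finset.sum_pair huw, hw, hwu1, one_mul, zero_mul, add_zero] at h2
      funext i
      by_cases hi : i = u
      · rw [hi]; exact h2
      · by_cases hi' : i = w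
        · rw [hi']; exact h1
        · exact hx.1 i (by simp [hi, hi'])
    obtain ⟨y, hy, hyw⟩ := hnl w hw
    have : nul C ({u, w} : Finset ι)ᶜ < nul C Finset.univ := by
      apply Submodule.finrank_lt_finrank_of_lt
      refine lt_of_le_of_ne ?_ ?_
      · intro z hz
        have e1 : C.mulVec z u = 0 := by simpa [hxu, hxw] using hpair2 u w huw x hx z hz
        have e2 : C.mulVec z w = 0 := by simpa [e1, hyw] using hpair2 u w huw y hy z hz
        rw [hU]
        intro i
        by_cases hi : i = u
        · rw [hi]; exact e1
        · by_cases hi' : i = w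
          · rw [hi']; exact e2
          · exact hz.2 i (by simp [hi, hi'])
      · intro he
        rw [← he] at hx
        rw [hx.1 u (by simp)] at hxu
        simp at hxu
    have := H {u, w}
    omega
  have hadj' : ∀ u w, u ≠ w → C u u = 0 → C w w = 0 → C u w = 1 →
      ∀ x ∈ ker C Finset.univ, x u = x w := by
    intro u w huw hu hw h x hx
    have hs : C w u = 1 := by rw [hC.apply]; exact h
    have e1 := hadj u w huw hu hw h x hx
    have e2 := hadj w u huw.symm hw hu hs x hx
    rcases z2 (x u) with h1 | h1
    · rcases z2 (x w) with h2 | h2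
      · rw [h1, h2]
      · rw [e2 h2, h2]
    · rw [h1, e1 h1]
  rcases z2 (C v v) with hv | hv
  · left
    have hreach : ∀ u, (interGraph C).Reachable u v →
        C u u = 0 ∧ ∀ x ∈ ker C Finset.univ, x u = x v := by
      rintro u ⟨p⟩
      induction p with
      | nil => exact ⟨hv, fun _ _ => rfl⟩
      | cons h p ih =>
        obtain ⟨i1, i2⟩ := ih hv
        obtain ⟨hne, h1⟩ := (adj_iff hC _ _).1 h
        have h0 := (z2 _).resolve_right fun hh => by
          have := hiso _ _ hne hh
          rw [this] at h1; simp at h1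
        exact ⟨h0, fun x hx => (hadj' _ _ hne h0 i1 h1 x hx).trans (i2 x hx)⟩
    have hcomp : ∀ u w : ι, (interGraph C).Reachable u v → (interGraph C).Reachable w v →
            u ≠ w → (interGraph C).Adj u w := by
      intro u w hu hw huw
      obtain ⟨a1, a2⟩ := hreach u hu
      obtain ⟨b1, b2⟩ := hreach w hw
      exact (adj_iff hC u w).2 ⟨huw, hnadj u w huw a1 b1
        fun x hx => (a2 x hx).trans (b2 x hx).symm⟩
    refine ⟨hcomp, ?_, fun u hu => (hreach u hu).1⟩
    obtain ⟨x, hx, hxv⟩ := hnl v hv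
    have hx0 : ∑ j, C v j * x j = 0 := hx.2 v (Finset.mem_univ v)
    have hval : ∀ j, C v j * x j + (if j = v then 1 else 0)
        = if (interGraph C).Reachable j v then 1 else 0 := by
      intro j
      by_cases hj : j = v
      · subst hj; simp [hv]
      · by_cases hr : (interGraph C).Reachable j v
        · have h1 := ((adj_iff hC _ _).1 (hcomp v j (SimpleGraph.Reachable.refl _) hr
            (Ne.symm hj))).2
          have h2 := (hreach j hr).2 x hx
          simp [hj, hr, h1, h2, hxv]
        · have h1 : C v j = 0 := (z2 _).resolve_right fun h => hr
            ((adj_iff hC v j).2 ⟨Ne.symm hj, h⟩).reachable.symm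
          simp [hj, hr, h1]
    have hsum := Finset.sum_congr (rfl : (Finset.univ : Finset ι) = Finset.univ)
      fun j _ => hval j
    rw [Finset.sum_add_distrib, hx0, zero_add, Finset.sum_ite_eq' , Finset.sum_boole] at hsum
    simp only [Finset.mem_univ, if_true] at hsum
    have ho := ZMod.natCast_eq_one_iff_odd.1 hsum.symm
    rw [Set.ncard_eq_toFinset_card']
    convert ho using 2
    ext; simp
  · right
    refine ⟨?_, hv⟩
    have : ∀ u, (interGraph C).Reachable v u → u = v := by
      rintro u ⟨p⟩
      cases p with
      | nil => rfl
      | cons h p =>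
        obtain ⟨hne, h1⟩ := (adj_iff hC _ _).1 h
        rw [hiso _ _ hne hv] at h1
        simp at h1
    exact fun u hu => this u hu.symm

/-- **Main Theorem.**  Let `D = D(C)` be a normal binary delta-matroid (with ground set the
whole finite index set).  The twist polynomial of `D` is a monomial (i.e. all twists have the
same width `k`) iff each connected component of the intersection graph `G_D` is either a
complete graph of odd order (with no loops at its vertices) or a single vertex with a loop. -/
theorem main_theorem (C : Matrix ι ι (ZMod 2)) (hC : C.IsSymm) :
    (∃ k : ℕ, ∀ A : Finset ι, width (twist (binaryFeasible C) A) = k) ↔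
      ∀ v : ι,
        ((∀ u w : ι, (interGraph C).Reachable u v → (interGraph C).Reachable w v →
            u ≠ w → (interGraph C).Adj u w) ∧
          Odd (Set.ncard {u : ι | (interGraph C).Reachable u v}) ∧
          (∀ u : ι, (interGraph C).Reachable u v → C u u = 0)) ∨
        ((∀ u : ι, (interGraph C).Reachable u v → u = v) ∧ C v v = 1) := by
  rw [const_iff hC]
  exact ⟨fun H v => forward_dir hC H v, fun H A => reverse_dir hC H A⟩

end DeltaMatroid

end
end

section
/- Let D=(E,𝓕) be a connected even normal binary delta-matroid. Then the twist polynomial of D is a monomial (i.e., there exists k with w(D*A)=k for all A⊆E) if and only if the intersection graph G_D is a complete graph of odd order. -/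
open Finset
open scoped symmDiff

noncomputable section

namespace DeltaMatroid

variable {α : Type*} [DecidableEq α]

variable {ι : Type*} [Fintype ι] [DecidableEq ι]

/-- Kernel characterization of feasibility. -/
lemma mem_feas_iff (C : Matrix ι ι (ZMod 2)) (A : Finset ι) :
    A ∈ binaryFeasible C ↔ ∀ k : ι → ZMod 2, (∀ i, i ∉ A → k i = 0) →
      (∀ i ∈ A, ∑ j, C i j * k j = 0) → k = 0 := by
  unfold binaryFeasible
  simp only [Finset.mem_filter, Finset.mem_univ, true_and]
  rw [← not_iff_not, not_not, ← Matrix.exists_mulVec_eq_zero_iff]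
  constructor
  · rintro ⟨v, hv0, hv⟩ h
    apply hv0
    have h1 := h (fun i => if hi : i ∈ A then v ⟨i, hi⟩ else 0) (by
      intro i hi; simp [hi]) (by
      intro i hi
      have h2 := congrFun hv ⟨i, hi⟩
      simp only [Matrix.mulVec, dotProduct, Matrix.submatrix_apply, Pi.zero_apply] at h2
      refine Eq.trans ?_ h2
      rw [← Finset.sum_subset (Finset.subset_univ A) (by
        intro x _ hx; simp [hx]), ← Finset.sum_coe_sort A]
      apply Finset.sum_congr rfl
      intro x _
      simp)
    funext x
    have := congrFun h1 x
    simpa using this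
  · intro h
    push Not at h
    obtain ⟨k, hk1, hk2, hk0⟩ := h
    refine ⟨fun x => k x, ?_, ?_⟩
    · intro h0
      apply hk0
      funext i
      by_cases hi : i ∈ A
      · exact congrFun h0 ⟨i, hi⟩
      · exact hk1 i hi
    · funext x
      simp only [Matrix.mulVec, dotProduct, Matrix.submatrix_apply, Pi.zero_apply]
      rw [← hk2 x x.2, ← Finset.sum_subset (Finset.subset_univ A) (by
        intro y _ hy; simp [hk1 y hy]), ← Finset.sum_coe_sort A]

lemma empty_mem_feas (C : Matrix ι ι (ZMod 2)) : ∅ ∈ binaryFeasible C := by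
  rw [mem_feas_iff]
  intro k hk _
  funext i
  exact hk i (by simp)

lemma z2_ne {a : ZMod 2} (h : a ≠ 1) : a = 0 := by
  revert a; decide

lemma single_mem_feas (C : Matrix ι ι (ZMod 2)) (v : ι) (h : C v v = 1) :
    {v} ∈ binaryFeasible C := by
  rw [mem_feas_iff]
  intro k hk hs
  have := hs v (by simp)
  rw [Finset.sum_eq_single v (by
    intro b _ hb; rw [hk b (by simpa using hb)]; simp) (by simp), h, one_mul] at this
  funext i
  by_cases hi : i = v
  · subst hi; exact this
  · exact hk i (by simpa using hi)

lemma pair_sum (C : Matrix ι ι (ZMod 2)) {u v : ι} (huv : u ≠ v) (k : ι → ZMod 2)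
    (hk : ∀ i, i ∉ ({u, v} : Finset ι) → k i = 0) (i : ι) :
    ∑ j, C i j * k j = C i u * k u + C i v * k v := by
  rw [← Finset.sum_pair huv (f := fun j => C i j * k j)]
  symm
  apply Finset.sum_subset (Finset.subset_univ _)
  intro x _ hx
  rw [hk x hx, mul_zero]

lemma pair_mem_feas (C : Matrix ι ι (ZMod 2)) (hC : C.IsSymm) (hd : ∀ v, C v v = 0)
    {u v : ι} (huv : u ≠ v) : {u, v} ∈ binaryFeasible C ↔ C u v = 1 := by
  have hs : C v u = C u v := hC.apply u v
  rw [mem_feas_iff]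
  constructor
  · intro h
    by_contra h1
    have h0 := z2_ne h1
    have := h (fun i => if i = u then 1 else 0) (by
      intro i hi
      have : i ≠ u := by rintro rfl; simp at hi
      simp [this]) (by
      intro i hi
      simp only [mul_ite, mul_one, mul_zero, Finset.sum_ite_eq', Finset.mem_univ, if_true]
      simp only [Finset.mem_insert, Finset.mem_singleton] at hi
      rcases hi with rfl | rfl
      · exact hd _
      · rw [hs, h0])
    have := congrFun this u
    simp at this
  · intro h k hk hs'
    have hu := hs' u (by simp)
    have hv := hs' v (by simp)
    rw [pair_sum C huv k hk] at hu hv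
    rw [hd, h] at hu
    rw [hd, hs, h] at hv
    funext i
    by_cases hi : i ∈ ({u, v} : Finset ι)
    · simp only [Finset.mem_insert, Finset.mem_singleton] at hi
      rcases hi with rfl | rfl
      · simpa using hv
      · simpa using hu
    · exact hk i hi

lemma card_sd {α : Type*} [DecidableEq α] (A X : Finset α) :
    (A ∆ X).card + 2 * (A ∩ X).card = A.card + X.card := by
  have h1 : (A ∆ X).card = (A \ X).card + (X \ A).card := by
    rw [symmDiff_def, Finset.sup_eq_union, Finset.card_union_of_disjoint disjoint_sdiff_sdiff]
  have h2 := Finset.card_sdiff_add_card_inter A X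
  have h3 := Finset.card_sdiff_add_card_inter X A
  rw [Finset.inter_comm X A] at h3
  omega

lemma width_eq_s12 {α : Type*} [DecidableEq α] (T : Finset (Finset α)) (P Q : Finset α) (hP : P ∈ T)
    (hQ : Q ∈ T) (h : ∀ Z ∈ T, P.card ≤ Z.card ∧ Z.card ≤ Q.card) :
    width T = Q.card - P.card := by
  have h1 : maxCard T = Q.card :=
    le_antisymm (Finset.sup_le fun Z hZ => (h Z hZ).2) (Finset.le_sup (f := Finset.card) hQ)
  have h2 : minCard T = P.card := by
    unfold minCard
    apply le_antisymm
    · exact Nat.sInf_le ⟨P, hP, rfl⟩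
    · apply le_csInf (Set.Nonempty.image _ ⟨P, hP⟩)
      rintro _ ⟨Z, hZ, rfl⟩
      exact (h Z hZ).1
  rw [width, h1, h2]

lemma exists_width {α : Type*} [DecidableEq α] (F : Finset (Finset α)) (hF : F.Nonempty)
    (A : Finset α) :
    ∃ P ∈ F, ∃ Q ∈ F, (∀ Z ∈ F, (A ∆ P).card ≤ (A ∆ Z).card ∧ (A ∆ Z).card ≤ (A ∆ Q).card) ∧
      width (twist F A) = (A ∆ Q).card - (A ∆ P).card := by
  obtain ⟨P, hP, hP'⟩ := Finset.exists_min_image F (fun Z => (A ∆ Z).card) hF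
  obtain ⟨Q, hQ, hQ'⟩ := Finset.exists_max_image F (fun Z => (A ∆ Z).card) hF
  refine ⟨P, hP, Q, hQ, fun Z hZ => ⟨hP' Z hZ, hQ' Z hZ⟩, ?_⟩
  apply width_eq_s12
  · exact Finset.mem_image_of_mem _ hP
  · exact Finset.mem_image_of_mem _ hQ
  · intro Z hZ
    obtain ⟨Y, hY, rfl⟩ := Finset.mem_image.1 hZ
    exact ⟨hP' Y hY, hQ' Y hY⟩

lemma mem_twist {α : Type*} [DecidableEq α] (F : Finset (Finset α)) (A Z : Finset α) :
    Z ∈ twist F A ↔ A ∆ Z ∈ F := by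
  unfold twist
  rw [Finset.mem_image]
  constructor
  · rintro ⟨X, hX, rfl⟩
    rwa [symmDiff_symmDiff_cancel_left]
  · intro h
    exact ⟨_, h, symmDiff_symmDiff_cancel_left _ _⟩

/-- The closed neighbourhood. -/
def cls (C : Matrix ι ι (ZMod 2)) (x : ι) : Finset ι :=
  Finset.univ.filter fun y => y = x ∨ C x y = 1

lemma mem_cls (C : Matrix ι ι (ZMod 2)) (x y : ι) : y ∈ cls C x ↔ y = x ∨ C x y = 1 := by
  simp [cls]

lemma cls_eq (C : Matrix ι ι (ZMod 2)) (hC : C.IsSymm)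
    (ht : ∀ u w v, C u w = 1 → C w v = 1 → u ≠ v → C u v = 1) {x y : ι} (h : y ∈ cls C x) :
    cls C y = cls C x := by
  rw [mem_cls] at h
  rcases h with rfl | h
  · rfl
  have h' : C y x = 1 := by rw [hC.apply]; exact h
  ext z
  rw [mem_cls, mem_cls]
  constructor
  · rintro (rfl | hz)
    · exact Or.inr h
    · by_cases e : z = x
      · exact Or.inl e
      · exact Or.inr (ht _ _ _ h hz (Ne.symm e))
  · rintro (rfl | hz)
    · exact Or.inr h'
    · by_cases e : z = y
      · exact Or.inl e
      · exact Or.inr (ht _ _ _ h' hz (Ne.symm e))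

lemma self_mem_cls (C : Matrix ι ι (ZMod 2)) (x : ι) : x ∈ cls C x := by simp [mem_cls]

lemma C_eq (C : Matrix ι ι (ZMod 2)) (hd : ∀ v, C v v = 0) (i j : ι) :
    C i j = (if j ∈ cls C i then 1 else 0) - (if j = i then 1 else 0) := by
  by_cases e : j = i
  · subst e; simp [hd, self_mem_cls]
  · by_cases h : C i j = 1
    · have : j ∈ cls C i := by rw [mem_cls]; exact Or.inr h
      simp [this, e, h]
    · have : j ∉ cls C i := by rw [mem_cls]; tauto
      simp [this, e, z2_ne h]

lemma row_sum (C : Matrix ι ι (ZMod 2)) (hd : ∀ v, C v v = 0) (i : ι) (k : ι → ZMod 2) :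
    ∑ j, C i j * k j = ∑ j ∈ cls C i, k j - k i := by
  have : ∀ j, C i j * k j = (if j ∈ cls C i then k j else 0) - (if j = i then k j else 0) := by
    intro j; rw [C_eq C hd i j, sub_mul]; simp
  simp only [this, Finset.sum_sub_distrib]
  simp

lemma feas_iff_even (C : Matrix ι ι (ZMod 2)) (hC : C.IsSymm) (hd : ∀ v, C v v = 0)
    (ht : ∀ u w v, C u w = 1 → C w v = 1 → u ≠ v → C u v = 1) (X : Finset ι) :
    X ∈ binaryFeasible C ↔ ∀ x, Even (X ∩ cls C x).card := by
  rw [mem_feas_iff]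
  constructor
  · intro h x
    by_contra hx
    rw [Nat.not_even_iff_odd] at hx
    have hx1 : ((X ∩ cls C x).card : ZMod 2) = 1 := (ZMod.natCast_eq_one_iff_odd).2 hx
    have hne : (X ∩ cls C x).Nonempty := by
      rw [← Finset.card_pos]; exact hx.pos
    obtain ⟨a, ha⟩ := hne
    have := h (fun j => if j ∈ X ∩ cls C x then 1 else 0) (by
      intro i hi; simp [hi]) (by
      intro i hi
      rw [row_sum C hd]
      by_cases hix : i ∈ cls C x
      · rw [cls_eq C hC ht hix]
        have : i ∈ X ∩ cls C x := Finset.mem_inter.2 ⟨hi, hix⟩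
        rw [if_pos this, Finset.sum_ite_mem, Finset.inter_comm X, ← Finset.inter_assoc,
          Finset.inter_self, Finset.inter_comm]
        simp [hx1]
      · have : i ∉ X ∩ cls C x := fun h => hix (Finset.mem_inter.1 h).2
        rw [if_neg this, sub_zero]
        apply Finset.sum_eq_zero
        intro j hj
        rw [if_neg]
        intro hj'
        have h2 := cls_eq C hC ht (Finset.mem_inter.1 hj').2
        have h3 := cls_eq C hC ht hj
        apply hix
        rw [← h2, h3]
        exact self_mem_cls C i)
    have := congrFun this a
    simp only [if_pos ha] at this
    simp at this
  · intro h k hk hs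
    have hs' : ∀ i ∈ X, k i = ∑ j ∈ cls C i, k j := by
      intro i hi
      have := hs i hi
      rw [row_sum C hd, sub_eq_zero] at this
      exact this.symm
    funext i
    by_cases hi : i ∈ X
    · have h1 : ∑ j ∈ X ∩ cls C i, k j = ∑ j ∈ cls C i, k j := by
        apply Finset.sum_subset Finset.inter_subset_right
        intro j hj hj'
        apply hk
        intro hjX
        exact hj' (Finset.mem_inter.2 ⟨hjX, hj⟩)
      have h2 : ∑ j ∈ X ∩ cls C i, k j = ∑ j ∈ X ∩ cls C i, k i := by
        apply Finset.sum_congr rfl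
        intro j hj
        rw [Finset.mem_inter] at hj
        rw [hs' j hj.1, hs' i hi, cls_eq C hC ht hj.2]
      rw [hs' i hi, ← h1, h2, Finset.sum_const, nsmul_eq_mul,
        (ZMod.natCast_eq_zero_iff_even).2 (h i), zero_mul]
      rfl
    · exact hk i hi

lemma even_sd_iff {α : Type*} [DecidableEq α] (A X : Finset α) :
    Even (A ∆ X).card ↔ (Even A.card ↔ Even X.card) := by
  have := card_sd A X
  simp only [Nat.even_iff]
  omega

lemma exchange (C : Matrix ι ι (ZMod 2)) (hC : C.IsSymm) (hd : ∀ v, C v v = 0)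
    (ht : ∀ u w v, C u w = 1 → C w v = 1 → u ≠ v → C u v = 1) (X Y : Finset ι)
    (hX : X ∈ binaryFeasible C) (hY : Y ∈ binaryFeasible C) (u : ι) (hu : u ∈ X ∆ Y) :
    ∃ v ∈ X ∆ Y, X ∆ ({u, v} : Finset ι) ∈ binaryFeasible C := by
  rw [feas_iff_even C hC hd ht] at hX hY
  have h1 : Even ((X ∆ Y) ∩ cls C u).card := by
    rw [← Finset.inf_eq_inter, inf_symmDiff_distrib_right, even_sd_iff]
    simp [hX, hY]
  have hu' : u ∈ (X ∆ Y) ∩ cls C u := Finset.mem_inter.2 ⟨hu, self_mem_cls C u⟩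
  have h2 : 1 < ((X ∆ Y) ∩ cls C u).card := by
    have := Finset.card_pos.2 ⟨u, hu'⟩
    rw [Nat.even_iff] at h1
    omega
  obtain ⟨v, hv, hvu⟩ := Finset.exists_mem_ne h2 u
  rw [Finset.mem_inter] at hv
  refine ⟨v, hv.1, ?_⟩
  rw [feas_iff_even C hC hd ht]
  intro x
  rw [← Finset.inf_eq_inter, inf_symmDiff_distrib_right, even_sd_iff]
  simp only [Finset.inf_eq_inter, hX, true_iff]
  have hiff : u ∈ cls C x ↔ v ∈ cls C x := by
    constructor
    · intro h; rw [← cls_eq C hC ht h]; exact hv.2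
    · intro h
      rw [← cls_eq C hC ht h, cls_eq C hC ht hv.2]
      exact self_mem_cls C u
  by_cases h : u ∈ cls C x
  · have hv' := hiff.1 h
    have : ({u, v} : Finset ι) ∩ cls C x = {u, v} := by
      apply Finset.inter_eq_left.2
      intro z hz
      simp only [Finset.mem_insert, Finset.mem_singleton] at hz
      rcases hz with rfl | rfl <;> assumption
    rw [this, Finset.card_pair hvu.symm]
    decide
  · have hv' := fun h' => h (hiff.2 h')
    have : ({u, v} : Finset ι) ∩ cls C x = ∅ := by
      ext z
      simp only [Finset.mem_inter, Finset.mem_insert, Finset.mem_singleton, Finset.notMem_empty,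
        iff_false, not_and]
      rintro (rfl | rfl) <;> assumption
    rw [this]
    simp

lemma filter_dm (C : Matrix ι ι (ZMod 2)) (hC : C.IsSymm) (hd : ∀ v, C v v = 0)
    (ht : ∀ u w v, C u w = 1 → C w v = 1 → u ≠ v → C u v = 1) (S : Finset ι) :
    IsDeltaMatroid S ((binaryFeasible C).filter fun X => X ⊆ S) := by
  refine ⟨⟨∅, by simp [empty_mem_feas]⟩, fun X hX => (Finset.mem_filter.1 hX).2, ?_⟩
  intro X hX Y hY u hu
  rw [Finset.mem_filter] at hX hY
  obtain ⟨v, hv, h⟩ := exchange C hC hd ht X Y hX.1 hY.1 u hu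
  refine ⟨v, hv, Finset.mem_filter.2 ⟨h, ?_⟩⟩
  have hsub : X ∆ Y ⊆ S := by
    intro z hz
    rw [Finset.mem_symmDiff] at hz
    rcases hz with hz | hz
    · exact hX.2 hz.1
    · exact hY.2 hz.1
  intro z hz
  rw [Finset.mem_symmDiff] at hz
  rcases hz with hz | hz
  · exact hX.2 hz.1
  · have := hz.1
    simp only [Finset.mem_insert, Finset.mem_singleton] at this
    rcases this with rfl | rfl
    · exact hsub hu
    · exact hsub hv

lemma complete_of_trans (C : Matrix ι ι (ZMod 2)) (hC : C.IsSymm) (hd : ∀ v, C v v = 0)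
    (ht : ∀ u w v, C u w = 1 → C w v = 1 → u ≠ v → C u v = 1)
    (hconn : IsConnected (Finset.univ : Finset ι) (binaryFeasible C)) (u v : ι) (huv : u ≠ v) :
    C u v = 1 := by
  by_contra hne
  apply hconn
  have hS : ∀ x, cls C x ⊆ cls C u ∨ cls C x ⊆ (cls C u)ᶜ := by
    intro x
    by_cases hx : x ∈ cls C u
    · left; rw [cls_eq C hC ht hx]
    · right
      intro z hz
      rw [Finset.mem_compl]
      intro hz'
      apply hx
      rw [← cls_eq C hC ht hz', cls_eq C hC ht hz]
      exact self_mem_cls C x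
  refine ⟨cls C u, (cls C u)ᶜ, _, _, ⟨u, self_mem_cls C u⟩, ⟨v, ?_⟩, disjoint_compl_right,
    (Finset.union_compl _).symm, filter_dm C hC hd ht _, filter_dm C hC hd ht _, ?_⟩
  · rw [Finset.mem_compl, mem_cls]
    rintro (h | h)
    · exact huv h.symm
    · exact hne h
  · ext X
    unfold directSum
    simp only [Finset.mem_image, Finset.mem_product, Finset.mem_filter, Prod.exists]
    constructor
    · intro hX
      refine ⟨X ∩ cls C u, X ∩ (cls C u)ᶜ, ⟨⟨?_, Finset.inter_subset_right⟩,
        ⟨?_, Finset.inter_subset_right⟩⟩, ?_⟩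
      · rw [feas_iff_even C hC hd ht] at hX ⊢
        intro x
        rcases hS x with h | h
        · rw [Finset.inter_assoc, Finset.inter_eq_right.2 h]; exact hX x
        · have : X ∩ cls C u ∩ cls C x = ∅ := by
            ext z
            have := @h z
            simp only [Finset.mem_compl] at this
            simp only [Finset.mem_inter, Finset.notMem_empty, iff_false]
            tauto
          simp [this]
      · rw [feas_iff_even C hC hd ht] at hX ⊢
        intro x
        rcases hS x with h | h
        · have : X ∩ (cls C u)ᶜ ∩ cls C x = ∅ := by
            ext z
            have := @h z
            simp only [Finset.mem_inter, Finset.notMem_empty, iff_false, Finset.mem_compl]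
            tauto
          simp [this]
        · rw [Finset.inter_assoc, Finset.inter_eq_right.2 h]; exact hX x
      · rw [← Finset.inter_union_distrib_left, Finset.union_compl, Finset.inter_univ]
    · rintro ⟨X1, X2, ⟨⟨h1, h1s⟩, h2, h2s⟩, rfl⟩
      rw [feas_iff_even C hC hd ht] at h1 h2 ⊢
      intro x
      have hdis : Disjoint (X1 ∩ cls C x) (X2 ∩ cls C x) := by
        rw [Finset.disjoint_left]
        intro z hz hz'
        have a := h1s (Finset.mem_inter.1 hz).1
        have b := h2s (Finset.mem_inter.1 hz').1
        exact Finset.mem_compl.1 b a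
      rw [Finset.union_inter_distrib_right, Finset.card_union_of_disjoint hdis]
      exact (h1 x).add (h2 x)

/-- Feasible sets index linearly independent rows. -/
lemma feas_indep (C : Matrix ι ι (ZMod 2)) (hC : C.IsSymm) (X : Finset ι)
    (hX : X ∈ binaryFeasible C) :
    LinearIndepOn (ZMod 2) (fun i => C i) (X : Set ι) := by
  rw [mem_feas_iff] at hX
  rw [linearIndepOn_finset_iff]
  intro f hf i hi
  have := hX (fun j => if j ∈ X then f j else 0) (by intro i hi; simp [hi]) (by
    intro a _
    have h1 := congrFun hf a
    simp only [Finset.sum_apply, Pi.smul_apply, smul_eq_mul, Pi.zero_apply] at h1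
    refine Eq.trans ?_ h1
    rw [← Finset.sum_subset (Finset.subset_univ X) (by
        intro x _ hx; simp [hx])]
    apply Finset.sum_congr rfl
    intro x hx
    rw [if_pos hx, mul_comm, hC.apply])
  have := congrFun this i
  simpa [hi] using this

lemma indep_feas (C : Matrix ι ι (ZMod 2)) (hC : C.IsSymm) (X : Finset ι)
    (hX : LinearIndepOn (ZMod 2) (fun i => C i) (X : Set ι))
    (hs : ∀ i, C i ∈ Submodule.span (ZMod 2) ((fun i => C i) '' (X : Set ι))) :
    X ∈ binaryFeasible C := by
  rw [mem_feas_iff]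
  intro k hk h0
  have hall : ∀ i, ∑ j, C i j * k j = 0 := by
    intro i
    have key : ∀ r ∈ Submodule.span (ZMod 2) ((fun i => C i) '' (X : Set ι)),
        ∑ j, r j * k j = 0 := by
      intro r hr
      induction hr using Submodule.span_induction with
      | mem x hx => obtain ⟨a, ha, rfl⟩ := hx; exact h0 a ha
      | zero => simp
      | add x y _ _ hx hy => simp [add_mul, Finset.sum_add_distrib, hx, hy]
      | smul a x _ hx => simp [mul_assoc, ← Finset.mul_sum, hx]
    exact key _ (hs i)
  rw [linearIndepOn_finset_iff] at hX
  have := hX k (by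
    funext a
    simp only [Finset.sum_apply, Pi.smul_apply, smul_eq_mul, Pi.zero_apply]
    rw [← hall a, ← Finset.sum_subset (Finset.subset_univ X) (by
        intro x _ hx; simp [hk x hx])]
    apply Finset.sum_congr rfl
    intro x hx
    rw [mul_comm, hC.apply])
  funext i
  by_cases hi : i ∈ X
  · exact this i hi
  · exact hk i hi

lemma max_indep (C : Matrix ι ι (ZMod 2)) (hC : C.IsSymm) (M : ℕ)
    (hM : ∀ Z ∈ binaryFeasible C, Z.card ≤ M) (X : Finset ι)
    (hX : LinearIndepOn (ZMod 2) (fun i => C i) (X : Set ι)) (hXM : M ≤ X.card) :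
    X ∈ binaryFeasible C ∧
      ∀ i, C i ∈ Submodule.span (ZMod 2) ((fun i => C i) '' (X : Set ι)) := by
  have hs : ∀ i, C i ∈ Submodule.span (ZMod 2) ((fun i => C i) '' (X : Set ι)) := by
    obtain ⟨b, hb, hXb, hsp, hbi⟩ :=
      exists_linearIndepOn_extension hX (Set.subset_univ (X : Set ι))
    have hcoe : ((b.toFinite.toFinset : Finset ι) : Set ι) = b := by simp
    have hf := indep_feas C hC b.toFinite.toFinset (by rw [hcoe]; exact hbi) (by
      intro i; rw [hcoe]; exact hsp ⟨i, trivial, rfl⟩)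
    have h1 := hM _ hf
    have h2 : X ⊆ b.toFinite.toFinset := by
      rw [← Finset.coe_subset, hcoe]; exact hXb
    have h3 := Finset.eq_of_subset_of_card_le h2 (by omega)
    intro i
    rw [h3, hcoe]
    exact hsp ⟨i, trivial, rfl⟩
  exact ⟨indep_feas C hC X hX hs, hs⟩

lemma basis_exchange (C : Matrix ι ι (ZMod 2)) (hC : C.IsSymm) (M : ℕ)
    (hM : ∀ Z ∈ binaryFeasible C, Z.card ≤ M) (X Y : Finset ι)
    (hX : X ∈ binaryFeasible C) (hY : Y ∈ binaryFeasible C) (hXM : X.card = M) (hYM : Y.card = M)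
    (w : ι) (hwX : w ∈ X) (hwY : w ∉ Y) :
    ∃ y ∈ Y, insert y (X.erase w) ∈ binaryFeasible C ∧ (insert y (X.erase w)).card = M := by
  have hXi := feas_indep C hC X hX
  have hYs := (max_indep C hC M hM Y (feas_indep C hC Y hY) hYM.ge).2
  have hXe : LinearIndepOn (ZMod 2) (fun i => C i) ((X.erase w : Finset ι) : Set ι) :=
    hXi.mono (by simp)
  have hex : ∃ y ∈ Y, C y ∉ Submodule.span (ZMod 2)
      ((fun i => C i) '' ((X.erase w : Finset ι) : Set ι)) := by
    by_contra hno
    push Not at hno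
    have hle : Submodule.span (ZMod 2) ((fun i => C i) '' (Y : Set ι)) ≤
      Submodule.span (ZMod 2) ((fun i => C i) '' ((X.erase w : Finset ι) : Set ι)) := by
      rw [Submodule.span_le]
      rintro _ ⟨y, hy, rfl⟩
      exact hno y hy
    have hw := hle (hYs w)
    rw [Finset.coe_erase] at hw
    exact LinearIndepOn.notMem_span hXi hwX hw
  obtain ⟨y, hy, hyn⟩ := hex
  have hyX : y ∉ X.erase w := fun h => hyn (Submodule.subset_span ⟨y, h, rfl⟩)
  have hc : (insert y (X.erase w)).card = M := by
    rw [Finset.card_insert_of_notMem hyX, Finset.card_erase_of_mem hwX, ← hXM]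
    have := Finset.card_pos.2 ⟨w, hwX⟩
    omega
  refine ⟨y, hy, (max_indep C hC M hM _ ?_ hc.ge).1, hc⟩
  rw [Finset.coe_insert]
  exact hXe.insert hyn

lemma width_complete (C : Matrix ι ι (ZMod 2)) [Nonempty ι] (hC : C.IsSymm)
    (hodd : Odd (Fintype.card ι)) (hcomp : ∀ u v : ι, u ≠ v → C u v = 1)
    (hd : ∀ v : ι, C v v = 0) (A : Finset ι) :
    width (twist (binaryFeasible C) A) = Fintype.card ι - 1 := by
  have hcls : ∀ x, cls C x = Finset.univ := by
    intro x
    ext y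
    rw [mem_cls]
    simp only [Finset.mem_univ, iff_true]
    by_cases h : y = x
    · exact Or.inl h
    · exact Or.inr (hcomp _ _ (Ne.symm h))
  obtain ⟨v⟩ := ‹Nonempty ι›
  have hF : ∀ X, X ∈ binaryFeasible C ↔ Even X.card := by
    intro X
    rw [feas_iff_even C hC hd (fun u _ v _ _ h => hcomp u v h)]
    simp only [hcls, Finset.inter_univ]
    exact ⟨fun h => h v, fun h _ => h⟩
  have hT : ∀ Z, Z ∈ twist (binaryFeasible C) A ↔ (Even A.card ↔ Even Z.card) := by
    intro Z; rw [mem_twist, hF, even_sd_iff]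
  have hn := hodd.pos
  have hle : ∀ Z : Finset ι, Z.card ≤ Fintype.card ι := fun Z => Finset.card_le_univ Z
  rw [Nat.odd_iff] at hodd
  have he : (Finset.univ.erase v).card = Fintype.card ι - 1 := by
    rw [Finset.card_erase_of_mem (Finset.mem_univ _), Finset.card_univ]
  by_cases hA : Even A.card
  · rw [width_eq_s12 _ ∅ (Finset.univ.erase v)]
    · rw [he]; simp
    · rw [hT]; simp [hA]
    · rw [hT, he]; simp only [hA, true_iff, Nat.even_iff]; omega
    · intro Z hZ
      rw [hT] at hZ
      simp only [hA, true_iff, Nat.even_iff] at hZ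
      have := hle Z
      rw [he, Finset.card_empty]
      omega
  · rw [width_eq_s12 _ {v} Finset.univ]
    · simp
    · rw [hT]; simp [hA]
    · rw [hT]; simp only [hA, false_iff, Nat.even_iff, Finset.card_univ]; omega
    · intro Z hZ
      rw [hT] at hZ
      simp only [hA, false_iff, Nat.even_iff] at hZ
      have := hle Z
      rw [Finset.card_singleton, Finset.card_univ]
      omega

/-- Let `D = D(C)` be a connected even normal binary delta-matroid (on a nonempty ground set).
Its twist polynomial is a monomial iff the intersection graph `G_D` is a complete graph of odd
order (in particular it has no loops). -/
theorem connected_even_monomial (C : Matrix ι ι (ZMod 2)) [Nonempty ι] (hC : C.IsSymm)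
    (hconn : IsConnected (Finset.univ : Finset ι) (binaryFeasible C))
    (heven : IsEvenDM (binaryFeasible C)) :
    (∃ k : ℕ, ∀ A : Finset ι, width (twist (binaryFeasible C) A) = k) ↔
      (Odd (Fintype.card ι) ∧ (∀ u v : ι, u ≠ v → C u v = 1) ∧ ∀ v : ι, C v v = 0) := by
  constructor
  · rintro ⟨k, hk⟩
    set F := binaryFeasible C with hFdef
    have h0 : ∅ ∈ F := empty_mem_feas C
    have hpar : ∀ X ∈ F, X.card % 2 = 0 := fun X hX => by
      have := heven X hX ∅ h0; simpa using this
    have hd : ∀ v, C v v = 0 := by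
      intro v
      apply z2_ne
      intro h
      have := hpar _ (single_mem_feas C v h)
      simp at this
    have hmax : ∀ Z ∈ F, Z.card ≤ k := by
      obtain ⟨P, hP, Q, hQ, hPQ, hw⟩ := exists_width F ⟨_, h0⟩ ∅
      rw [hk] at hw
      intro Z hZ
      have h1 := (hPQ ∅ h0).1
      have h2 := (hPQ Z hZ).2
      simp only [← Finset.bot_eq_empty, bot_symmDiff] at h1 h2 hw
      simp at h1
      subst h1
      simp at hw
      omega
    have hsingle : ∀ u, ∃ X ∈ F, X.card = k ∧ u ∉ X := by
      intro u
      obtain ⟨P, hP, Q, hQ, hPQ, hw⟩ := exists_width F ⟨_, h0⟩ {u}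
      rw [hk] at hw
      have h1 := (hPQ Q hQ).1
      have hPp := hpar P hP
      have hQm := hmax Q hQ
      have c1 := card_sd {u} P
      have c2 := card_sd {u} Q
      rw [Finset.card_singleton] at c1 c2
      refine ⟨Q, hQ, by omega, ?_⟩
      intro hu
      rw [Finset.inter_eq_left.2 (Finset.singleton_subset_iff.2 hu), Finset.card_singleton] at c2
      omega
    have hedge : ∀ u v, u ≠ v → C u v = 1 → ∀ X ∈ F, X.card = k → u ∉ X → v ∈ X := by
      intro u v huv he X hX hXk hu
      by_contra hv
      have hm : {u, v} ∈ F := (pair_mem_feas C hC hd huv).2 he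
      obtain ⟨P, hP, Q, hQ, hPQ, hw⟩ := exists_width F ⟨_, h0⟩ {u, v}
      rw [hk] at hw
      have h1 := (hPQ _ hm).1
      have h2 := (hPQ X hX).2
      have c := card_sd {u, v} X
      have e : ({u, v} : Finset ι) ∩ X = ∅ := by
        ext z
        simp only [Finset.mem_inter, Finset.mem_insert, Finset.mem_singleton,
          Finset.notMem_empty, iff_false, not_and]
        rintro (rfl | rfl) <;> assumption
      rw [e, Finset.card_pair huv, Finset.card_empty] at c
      rw [symmDiff_self, Finset.bot_eq_empty, Finset.card_empty] at h1
      omega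
    have hnon : ∀ u v, u ≠ v → C u v ≠ 1 → ∃ X ∈ F, X.card = k ∧ u ∉ X ∧ v ∉ X := by
      intro u v huv he
      have hm : {u, v} ∉ F := fun h => he ((pair_mem_feas C hC hd huv).1 h)
      obtain ⟨P, hP, Q, hQ, hPQ, hw⟩ := exists_width F ⟨_, h0⟩ {u, v}
      rw [hk] at hw
      have h1 := (hPQ Q hQ).1
      have hPp := hpar P hP
      have hQm := hmax Q hQ
      have c1 := card_sd {u, v} P
      have c2 := card_sd {u, v} Q
      rw [Finset.card_pair huv] at c1 c2
      have hne : (({u, v} : Finset ι) ∆ P).card ≠ 0 := by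
        intro h
        rw [Finset.card_eq_zero, ← Finset.bot_eq_empty, symmDiff_eq_bot] at h
        rw [h] at hm
        exact hm hP
      have hi : (({u, v} : Finset ι) ∩ Q).card = 0 := by omega
      rw [Finset.card_eq_zero] at hi
      refine ⟨Q, hQ, by omega, ?_, ?_⟩
      · intro hu
        have : u ∈ ({u, v} : Finset ι) ∩ Q := by simp [hu]
        rw [hi] at this; simp at this
      · intro hu
        have : v ∈ ({u, v} : Finset ι) ∩ Q := by simp [hu]
        rw [hi] at this; simp at this
    have hne_of : ∀ u v, C u v = 1 → u ≠ v := by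
      rintro u v h rfl
      rw [hd] at h
      exact zero_ne_one h
    have ht : ∀ u w v, C u w = 1 → C w v = 1 → u ≠ v → C u v = 1 := by
      intro u w v huw hwv huv
      by_contra hno
      obtain ⟨X, hX, hXk, huX, hvX⟩ := hnon u v huv hno
      obtain ⟨Y, hY, hYk, hwY⟩ := hsingle w
      have hwX := hedge u w (hne_of _ _ huw) huw X hX hXk huX
      obtain ⟨y, hy, hZ, hZk⟩ := basis_exchange C hC k hmax X Y hX hY hXk hYk w hwX hwY
      have hwZ : w ∉ insert y (X.erase w) := by
        intro h
        rw [Finset.mem_insert] at h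
        rcases h with rfl | h
        · exact hwY hy
        · simp at h
      have hwu : C w u = 1 := by rw [hC.apply]; exact huw
      have a := hedge w u (hne_of _ _ hwu) hwu _ hZ hZk hwZ
      have b := hedge w v (hne_of _ _ hwv) hwv _ hZ hZk hwZ
      simp only [Finset.mem_insert, Finset.mem_erase, huX, hvX, and_false, or_false] at a b
      exact huv (a.trans b.symm)
    have hcomp := complete_of_trans C hC hd ht hconn
    refine ⟨?_, hcomp, hd⟩
    by_contra hodd
    rw [Nat.not_odd_iff_even] at hodd
    have hU : Finset.univ ∈ F := by
      rw [hFdef, feas_iff_even C hC hd ht]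
      intro x
      have : cls C x = Finset.univ := by
        ext y
        rw [mem_cls]
        simp only [Finset.mem_univ, iff_true]
        by_cases h : y = x
        · exact Or.inl h
        · exact Or.inr (hcomp _ _ (Ne.symm h))
      rw [this, Finset.inter_self, Finset.card_univ]
      exact hodd
    obtain ⟨u⟩ := ‹Nonempty ι›
    obtain ⟨X, _, hXk, huX⟩ := hsingle u
    have h1 := hmax _ hU
    have h2 := Finset.eq_of_subset_of_card_le (Finset.subset_univ X) (by omega)
    rw [h2] at huX
    exact huX (Finset.mem_univ _)
  · rintro ⟨hodd, hcomp, hd⟩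
    exact ⟨_, width_complete C hC hodd hcomp hd⟩

end DeltaMatroid

end
end

section
/- Let E be a finite set and C a symmetric |E|×|E| matrix over GF(2) with rows and columns indexed by E. Then D(C)=(E,{A⊆E : the principal submatrix C[A] is nonsingular}), where C[∅] is nonsingular by convention, is a normal delta-matroid. -/
open Finset
open scoped symmDiff

noncomputable section

namespace DeltaMatroid

variable {α : Type*} [DecidableEq α]

variable {ι : Type*} [Fintype ι] [DecidableEq ι]

/-- Kernel formulation of nonsingularity of the principal submatrix `C[A]`. -/
def KerFeas (C : Matrix ι ι (ZMod 2)) (A : Finset ι) : Prop :=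
  ∀ x : ι → ZMod 2, (∀ i, i ∉ A → x i = 0) → (∀ i, i ∈ A → (C.mulVec x) i = 0) → x = 0

theorem mem_binaryFeasible_iff (C : Matrix ι ι (ZMod 2)) (A : Finset ι) :
    A ∈ binaryFeasible C ↔ KerFeas C A := by
  have key : ∀ x : ι → ZMod 2, (∀ i, i ∉ A → x i = 0) → ∀ i : {a // a ∈ A},
      ((C.submatrix (fun x : {a // a ∈ A} => (x : ι))
        (fun x : {a // a ∈ A} => (x : ι))).mulVec (fun j => x j)) i = (C.mulVec x) i := by
    intro x hx i
    simp only [Matrix.mulVec, dotProduct, Matrix.submatrix_apply]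
    rw [Finset.sum_coe_sort A (fun j => C i j * x j)]
    apply Finset.sum_subset (Finset.subset_univ _)
    intro j _ hj
    rw [hx j hj, mul_zero]
  simp only [binaryFeasible, Finset.mem_filter, Finset.mem_univ, true_and]
  rw [ne_eq, ← Matrix.exists_mulVec_eq_zero_iff]
  constructor
  · intro h x hx hx'
    by_contra hne
    apply h
    refine ⟨fun j => x j, ?_, ?_⟩
    · intro h0
      apply hne
      funext i
      by_cases hi : i ∈ A
      · exact congrFun h0 ⟨i, hi⟩
      · exact hx i hi
    · funext i
      rw [key x hx i]
      exact hx' i i.2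
  · rintro h ⟨w, hw, hw'⟩
    apply hw
    let x : ι → ZMod 2 := fun i => if hi : i ∈ A then w ⟨i, hi⟩ else 0
    have hxs : ∀ i, i ∉ A → x i = 0 := fun i hi => by simp [x, hi]
    have hxw : (fun j : {a // a ∈ A} => x j) = w := by
      funext j
      simp [x]
    have h0 := h x hxs (fun i hi => by
      rw [← key x hxs ⟨i, hi⟩, hxw, hw']
      rfl)
    rw [← hxw, h0]
    rfl

theorem exists_pivot (C : Matrix ι ι (ZMod 2)) (hC : C.IsSymm) (X : Finset ι)
    (hX : KerFeas C X) :
    ∃ M : Matrix ι ι (ZMod 2), M.IsSymm ∧ ∀ A, KerFeas M A ↔ KerFeas C (X ∆ A) := by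
  let P : (ι → ZMod 2) →ₗ[ZMod 2] (ι → ZMod 2) :=
    { toFun := fun x i => if i ∈ X then (C.mulVec x) i else x i
      map_add' := fun x y => by
        funext i
        by_cases hi : i ∈ X <;> simp [hi, Matrix.mulVec_add]
      map_smul' := fun c x => by
        funext i
        by_cases hi : i ∈ X <;> simp [hi, Matrix.mulVec_smul] }
  let Q : (ι → ZMod 2) →ₗ[ZMod 2] (ι → ZMod 2) :=
    { toFun := fun x i => if i ∈ X then x i else (C.mulVec x) i
      map_add' := fun x y => by
        funext i
        by_cases hi : i ∈ X <;> simp [hi, Matrix.mulVec_add]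
      map_smul' := fun c x => by
        funext i
        by_cases hi : i ∈ X <;> simp [hi, Matrix.mulVec_smul] }
  have hP : ∀ x i, P x i = if i ∈ X then (C.mulVec x) i else x i := fun _ _ => rfl
  have hQ : ∀ x i, Q x i = if i ∈ X then x i else (C.mulVec x) i := fun _ _ => rfl
  have hinj : Function.Injective P := by
    rw [injective_iff_map_eq_zero]
    intro x hx
    apply hX x
    · intro i hi
      have := congrFun hx i
      rwa [hP, if_neg hi] at this
    · intro i hi
      have := congrFun hx i
      rwa [hP, if_pos hi] at this
  let e := LinearEquiv.ofInjectiveEndo P hinj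
  have he : ∀ x, e x = P x := fun _ => rfl
  let M := LinearMap.toMatrix' (Q ∘ₗ e.symm.toLinearMap)
  have hM : ∀ x, M.mulVec (P x) = Q x := by
    intro x
    rw [← he, LinearMap.toMatrix'_mulVec]
    simp
  have hsym : ∀ x y, P x ⬝ᵥ Q y = P y ⬝ᵥ Q x := by
    intro x y
    have h1 : x ⬝ᵥ C.mulVec y = y ⬝ᵥ C.mulVec x := by
      rw [Matrix.dotProduct_mulVec, ← Matrix.mulVec_transpose, hC.eq, dotProduct_comm]
    rw [← sub_eq_zero] at h1 ⊢
    rw [← h1]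
    simp only [dotProduct, ← Finset.sum_sub_distrib]
    apply Finset.sum_congr rfl
    intro i _
    rw [hP, hP, hQ, hQ]
    by_cases hi : i ∈ X
    · simp only [if_pos hi, CharTwo.sub_eq_add]
      ring
    · simp only [if_neg hi]
  refine ⟨M, ?_, ?_⟩
  · ext i j
    rw [Matrix.transpose_apply]
    obtain ⟨x, hx⟩ := e.surjective (Pi.single i 1)
    obtain ⟨y, hy⟩ := e.surjective (Pi.single j 1)
    rw [he] at hx hy
    have := hsym x y
    rw [← hM, ← hM, hx, hy] at this
    simpa using this.symm
  · have t1 : ∀ A x, (∀ i, i ∉ X ∆ A → x i = 0) ∧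
          (∀ i, i ∈ X ∆ A → (C.mulVec x) i = 0) ↔
        (∀ i, i ∉ A → P x i = 0) ∧ (∀ i, i ∈ A → Q x i = 0) := by
      intro A x
      rw [← forall_and, ← forall_and]
      apply forall_congr'
      intro i
      rw [hP, hQ, Finset.mem_symmDiff]
      by_cases hi : i ∈ X <;> by_cases hA : i ∈ A <;> simp [hi, hA]
    intro A
    constructor
    · intro h x h1 h2
      obtain ⟨h3, h4⟩ := (t1 A x).1 ⟨h1, h2⟩
      apply hinj
      rw [map_zero]
      exact h _ h3 (by rw [hM]; exact h4)
    · intro h p h1 h2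
      obtain ⟨x, rfl⟩ := e.surjective p
      rw [he] at h1 h2 ⊢
      rw [hM] at h2
      obtain ⟨h3, h4⟩ := (t1 A x).2 ⟨h1, h2⟩
      rw [h x h3 h4, map_zero]

theorem exists_pair (M : Matrix ι ι (ZMod 2)) (hM : M.IsSymm) (A : Finset ι)
    (hA : KerFeas M A) (u : ι) (hu : u ∈ A) : ∃ v ∈ A, KerFeas M {u, v} := by
  by_cases huu : M u u = 0
  · have : ∃ v ∈ A, M u v ≠ 0 := by
      by_contra! hcon
      have h0 := hA (Pi.single u 1) (fun i hi => by
        have : i ≠ u := fun h => hi (h ▸ hu)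
        simp [this]) (fun i hi => by
        have := hcon i hi
        rw [← hM.apply] at this
        simpa using this)
      have := congrFun h0 u
      simp at this
    obtain ⟨v, hv, huv⟩ := this
    have hne : u ≠ v := fun h => huv (h ▸ huu)
    refine ⟨v, hv, ?_⟩
    intro x h1 h2
    have hs : ∀ i, (M.mulVec x) i = M i u * x u + M i v * x v := by
      intro i
      rw [Matrix.mulVec, dotProduct, ← Finset.sum_pair (f := fun j => M i j * x j) hne]
      symm
      apply Finset.sum_subset (Finset.subset_univ _)
      intro j _ hj
      rw [h1 j hj, mul_zero]
    have e1 := h2 u (by simp)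
    have e2 := h2 v (by simp)
    rw [hs, huu, zero_mul, zero_add] at e1
    have hxv : x v = 0 := (mul_eq_zero.1 e1).resolve_left huv
    rw [hs, hxv, mul_zero, add_zero, hM.apply] at e2
    have hxu : x u = 0 := (mul_eq_zero.1 e2).resolve_left huv
    funext i
    by_cases hi : i ∈ ({u, v} : Finset ι)
    · rcases (by simpa using hi : i = u ∨ i = v) with rfl | rfl <;> assumption
    · exact h1 i hi
  · refine ⟨u, hu, ?_⟩
    intro x h1 h2
    have hs : (M.mulVec x) u = M u u * x u := by
      rw [Matrix.mulVec, dotProduct]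
      apply Finset.sum_eq_single u
      · intro j _ hj
        rw [h1 j (by simpa using hj), mul_zero]
      · simp
    have e1 := h2 u (by simp)
    rw [hs] at e1
    have hxu : x u = 0 := (mul_eq_zero.1 e1).resolve_left huu
    funext i
    by_cases hi : i = u
    · rw [hi]; exact hxu
    · exact h1 i (by simpa using hi)

/-- For a symmetric matrix `C` over `GF(2)`, `D(C)` is a normal delta-matroid. -/
theorem binaryFeasible_isNormalDeltaMatroid (C : Matrix ι ι (ZMod 2)) (hC : C.IsSymm) :
    ∅ ∈ binaryFeasible C ∧ IsDeltaMatroid Finset.univ (binaryFeasible C) := by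
  have h0 : ∅ ∈ binaryFeasible C := by
    rw [mem_binaryFeasible_iff]
    intro x hx _
    funext i
    exact hx i (by simp)
  refine ⟨h0, ⟨∅, h0⟩, fun X _ => Finset.subset_univ X, ?_⟩
  intro X hX Y hY u hu
  rw [mem_binaryFeasible_iff] at hX hY
  obtain ⟨M, hM, hpiv⟩ := exists_pivot C hC X hX
  have hA : KerFeas M (X ∆ Y) := by
    rw [hpiv, symmDiff_symmDiff_cancel_left]
    exact hY
  obtain ⟨v, hv, hf⟩ := exists_pair M hM (X ∆ Y) hA u hu
  exact ⟨v, hv, (mem_binaryFeasible_iff _ _).2 ((hpiv _).1 hf)⟩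

end DeltaMatroid

end
end
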